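/- Let d ≥ 1, let Δ be a simplicial complex on the vertex set [d] = {1,...,d}, and let P_Δ ⊂ ℝ^d be the convex hull of the indicator vectors of the faces of Δ. Then the following conditions are equivalent: (i) Γ(O_P, P_Δ) is a reflexive polytope for some finite partially ordered set P on [d]; (ii) Γ(O_P, P_Δ) is a reflexive polytope for all finite partially ordered sets P on [d]; (iii) Ω(O_P, P_Δ) has the integer decomposition property for some finite partially ordered set P on [d]; (iv) Ω(O_P, P_Δ) has the integer decomposition property for all finite partially ordered sets P on [d]; (v) there exists a perfect graph G on [d] such that P_Δ equals the stable set polytope Q_G of G. -/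

import Mathlib

open scoped Pointwise

namespace HibiTsuchiya

/-- A point of `ℝ^n` is a *lattice point* if all of its coordinates are integers. -/
def IsLatticePoint {n : ℕ} (x : Fin n → ℝ) : Prop := ∀ i, ∃ z : ℤ, x i = (z : ℝ)

/-- The dual polytope `P^∨ = {x : ⟨x,y⟩ ≤ 1 for all y ∈ P}`. -/
def dualPolytope {n : ℕ} (P : Set (Fin n → ℝ)) : Set (Fin n → ℝ) :=
  {x | ∀ y ∈ P, ∑ i, x i * y i ≤ 1}

/-- A polytope `P ⊆ ℝ^n` is *reflexive* if the origin is an interior point of `P` and the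
dual polytope of `P` is again a lattice polytope (i.e. the convex hull of finitely many
lattice points). -/
def IsReflexive {n : ℕ} (P : Set (Fin n → ℝ)) : Prop :=
  0 ∈ interior P ∧
    ∃ V : Finset (Fin n → ℝ), (∀ v ∈ V, IsLatticePoint v) ∧
      dualPolytope P = convexHull ℝ (V : Set (Fin n → ℝ))

/-- `P` has the *integer decomposition property* if every lattice point of `m • P` (`m ≥ 1`)
is a sum of `m` lattice points of `P`. -/
def HasIDP {n : ℕ} (P : Set (Fin n → ℝ)) : Prop :=
  ∀ m : ℕ, 0 < m → ∀ a : Fin n → ℝ, IsLatticePoint a → a ∈ (m : ℝ) • P →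
    ∃ f : Fin m → Fin n → ℝ, (∀ k, f k ∈ P ∧ IsLatticePoint (f k)) ∧ a = ∑ k, f k

/-- The indicator vector `ρ(S) = ∑_{j ∈ S} e_j` of a subset `S ⊆ [n]`. -/
noncomputable def indicator {n : ℕ} (S : Set (Fin n)) : Fin n → ℝ :=
  S.indicator (fun _ => (1 : ℝ))

/-- A poset ideal of a partial order `P` on `[n]`. -/
def IsPosetIdeal {n : ℕ} (P : PartialOrder (Fin n)) (I : Set (Fin n)) : Prop :=
  ∀ i ∈ I, ∀ j, P.le j i → j ∈ I

/-- The order polytope `O_P`: the convex hull of the indicator vectors of poset ideals. -/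
noncomputable def orderPolytope {n : ℕ} (P : PartialOrder (Fin n)) : Set (Fin n → ℝ) :=
  convexHull ℝ {x | ∃ I : Set (Fin n), IsPosetIdeal P I ∧ x = indicator I}

/-- An antichain of a partial order `P` on `[n]`: a pairwise incomparable subset. -/
def IsPosetAntichain {n : ℕ} (P : PartialOrder (Fin n)) (A : Set (Fin n)) : Prop :=
  ∀ i ∈ A, ∀ j ∈ A, i ≠ j → ¬ P.le i j ∧ ¬ P.le j i

/-- The chain polytope `C_P`: the convex hull of the indicator vectors of antichains. -/
noncomputable def chainPolytope {n : ℕ} (P : PartialOrder (Fin n)) : Set (Fin n → ℝ) :=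
  convexHull ℝ {x | ∃ A : Set (Fin n), IsPosetAntichain P A ∧ x = indicator A}

/-- A stable (independent) set of a graph. -/
def IsStableSet {V : Type*} (G : SimpleGraph V) (S : Set V) : Prop :=
  ∀ i ∈ S, ∀ j ∈ S, ¬ G.Adj i j

/-- The stable set polytope `Q_G`: the convex hull of the indicator vectors of stable sets. -/
noncomputable def stableSetPolytope {n : ℕ} (G : SimpleGraph (Fin n)) : Set (Fin n → ℝ) :=
  convexHull ℝ {x | ∃ S : Set (Fin n), IsStableSet G S ∧ x = indicator S}

/-- The clique number of a graph, as an extended natural number. -/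
noncomputable def cliqueNumber {V : Type*} (G : SimpleGraph V) : ℕ∞ :=
  ⨆ (t : Finset V) (_ : G.IsClique (t : Set V)), (t.card : ℕ∞)

/-- A graph is *perfect* if for every induced subgraph (including the graph itself)
the chromatic number equals the clique number. -/
def IsPerfectGraph {V : Type*} (G : SimpleGraph V) : Prop :=
  ∀ s : Set V, (G.induce s).chromaticNumber = cliqueNumber (G.induce s)

/-- A simplicial complex on the vertex set `[n]`. -/
def IsSimplicialComplex {n : ℕ} (Δ : Set (Finset (Fin n))) : Prop :=
  (∀ i : Fin n, {i} ∈ Δ) ∧ ∀ F ∈ Δ, ∀ F' ⊆ F, F' ∈ Δ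

/-- The polytope `P_Δ`: the convex hull of the indicator vectors of the faces of `Δ`. -/
noncomputable def complexPolytope {n : ℕ} (Δ : Set (Finset (Fin n))) : Set (Fin n → ℝ) :=
  convexHull ℝ {x | ∃ F ∈ Δ, x = indicator (↑F : Set (Fin n))}

/-- `Γ(P,Q) = conv(P ∪ (−Q))`. -/
noncomputable def gammaPolytope {n : ℕ} (P Q : Set (Fin n → ℝ)) : Set (Fin n → ℝ) :=
  convexHull ℝ (P ∪ -Q)

/-- `Ω(P,Q) = conv((P × {1}) ∪ ((−Q) × {−1})) ⊆ ℝ^{n+1}`. -/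
noncomputable def omegaPolytope {n : ℕ} (P Q : Set (Fin n → ℝ)) : Set (Fin (n+1) → ℝ) :=
  convexHull ℝ
    ((fun x : Fin n → ℝ => Fin.snoc x (1 : ℝ)) '' P ∪
     (fun x : Fin n → ℝ => Fin.snoc x (-1 : ℝ)) '' (-Q))


/-! ### Basic tools -/

/-- Multiplicity of `i` in a multiset of finite sets. -/
def mult {d : ℕ} (L : Multiset (Finset (Fin d))) (i : Fin d) : ℤ :=
  (L.map (fun F => if i ∈ F then (1 : ℤ) else 0)).sum

/-- `u` is covered by at most `N` faces of `Δ`. -/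
def CovN {d : ℕ} (Δ : Set (Finset (Fin d))) (u : Fin d → ℤ) (N : ℕ) : Prop :=
  ∃ L : Multiset (Finset (Fin d)), (∀ F ∈ L, F ∈ Δ) ∧ L.card ≤ N ∧ ∀ i, u i ≤ mult L i

/-- A clique with respect to `Δ`: any two elements form a non-face. -/
def Cl {d : ℕ} (Δ : Set (Finset (Fin d))) (C : Finset (Fin d)) : Prop :=
  ∀ i ∈ C, ∀ j ∈ C, i ≠ j → ({i, j} : Finset (Fin d)) ∉ Δ

/-- The covering property characterising perfection. -/
def Cov {d : ℕ} (Δ : Set (Finset (Fin d))) : Prop :=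
  ∀ (N : ℕ) (u : Fin d → ℤ), (∀ i, 0 ≤ u i) →
    (∀ C, Cl Δ C → ∑ i ∈ C, u i ≤ (N : ℤ)) → CovN Δ u N

@[simp] lemma mult_zero {d : ℕ} (i : Fin d) : mult 0 i = 0 := by simp [mult]

@[simp] lemma mult_cons {d : ℕ} (F : Finset (Fin d)) (L) (i : Fin d) :
    mult (F ::ₘ L) i = (if i ∈ F then (1 : ℤ) else 0) + mult L i := by simp [mult]

@[simp] lemma mult_add {d : ℕ} (L L' : Multiset (Finset (Fin d))) (i : Fin d) :
    mult (L + L') i = mult L i + mult L' i := by simp [mult]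

lemma mult_nonneg {d : ℕ} (L : Multiset (Finset (Fin d))) (i : Fin d) : 0 ≤ mult L i := by
  induction L using Multiset.induction with
  | empty => simp
  | cons F L ih => rw [mult_cons]; split_ifs <;> omega

lemma mult_nsmul {d : ℕ} (n : ℕ) (L : Multiset (Finset (Fin d))) (i : Fin d) :
    mult (n • L) i = n * mult L i := by
  induction n with
  | zero => simp
  | succ n ih => rw [succ_nsmul, mult_add, ih]; push_cast; ring

lemma mult_finset {d : ℕ} {ι : Type*} (s : Finset ι) (F : ι → Finset (Fin d)) (i : Fin d) :
    mult (s.val.map F) i = ∑ k ∈ s, if i ∈ F k then (1 : ℤ) else 0 := by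
  rw [mult, Multiset.map_map]; rfl

lemma mult_pos {d : ℕ} (L : Multiset (Finset (Fin d))) (i : Fin d) (h : 0 < mult L i) :
    ∃ F ∈ L, i ∈ F := by
  induction L using Multiset.induction with
  | empty => simp at h
  | cons F L ih =>
    rw [mult_cons] at h
    by_cases hi : i ∈ F
    · exact ⟨F, by simp, hi⟩
    · simp [hi] at h
      obtain ⟨F', h1, h2⟩ := ih h
      exact ⟨F', by simp [h1], h2⟩

lemma face_clique {d : ℕ} {Δ : Set (Finset (Fin d))} (hΔ : IsSimplicialComplex Δ)
    {F C : Finset (Fin d)} (hF : F ∈ Δ) (hC : Cl Δ C) :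
    ∑ i ∈ C, (if i ∈ F then (1 : ℤ) else 0) ≤ 1 := by
  rw [Finset.sum_ite_mem, Finset.sum_const, nsmul_eq_mul, mul_one]
  norm_cast
  rw [Finset.card_le_one]
  intro a ha b hb
  by_contra hab
  rw [Finset.mem_inter] at ha hb
  refine hC a ha.1 b hb.1 hab (hΔ.2 F hF _ ?_)
  intro x hx
  simp at hx
  rcases hx with rfl | rfl
  exacts [ha.2, hb.2]

lemma mult_clique {d : ℕ} {Δ : Set (Finset (Fin d))} (hΔ : IsSimplicialComplex Δ)
    {L : Multiset (Finset (Fin d))} (hL : ∀ F ∈ L, F ∈ Δ) {C : Finset (Fin d)} (hC : Cl Δ C) :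
    ∑ i ∈ C, mult L i ≤ L.card := by
  induction L using Multiset.induction with
  | empty => simp
  | cons F L ih =>
    have h1 := ih (fun F' h => hL F' (by simp [h]))
    have h2 := face_clique hΔ (hL F (by simp)) hC
    simp only [mult_cons, Finset.sum_add_distrib, Multiset.card_cons]
    push_cast
    linarith

lemma shrink {d : ℕ} {Δ : Set (Finset (Fin d))} (hΔ : IsSimplicialComplex Δ)
    (L : Multiset (Finset (Fin d))) (hL : ∀ F ∈ L, F ∈ Δ) (u : Fin d → ℤ)
    (h0 : ∀ i, 0 ≤ u i) (hu : ∀ i, u i ≤ mult L i) :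
    ∃ L' : Multiset (Finset (Fin d)), (∀ F ∈ L', F ∈ Δ) ∧ L'.card = L.card ∧
      ∀ i, u i = mult L' i := by
  induction L using Multiset.induction generalizing u with
  | empty =>
    refine ⟨0, by simp, rfl, fun i => ?_⟩
    have := hu i; have := h0 i; simp at *; omega
  | cons F L ih =>
    set F' := F.filter (fun i => mult L i < u i) with hF'
    obtain ⟨L', h1, h2, h3⟩ := ih (fun F' h => hL F' (by simp [h]))
      (fun i => u i - if i ∈ F' then 1 else 0) (by
        intro i
        have := h0 i
        have := mult_nonneg L i
        by_cases hi : i ∈ F'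
        · have hh := (Finset.mem_filter.1 hi).2
          simp [hi]; omega
        · simp [hi]; omega) (by
        intro i
        have := hu i
        rw [mult_cons] at this
        simp only [hF', Finset.mem_filter]
        split_ifs at * <;> grind)
    refine ⟨F' ::ₘ L', ?_, by simp [h2], ?_⟩
    · intro E hE
      rcases Multiset.mem_cons.1 hE with rfl | hE
      · exact hΔ.2 F (hL F (by simp)) _ (Finset.filter_subset _ _)
      · exact h1 E hE
    · intro i
      rw [mult_cons, ← h3 i]; ring

lemma empty_face {d : ℕ} (hd : 1 ≤ d) {Δ : Set (Finset (Fin d))} (hΔ : IsSimplicialComplex Δ) :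
    ∅ ∈ Δ := hΔ.2 _ (hΔ.1 ⟨0, hd⟩) _ (by simp)

lemma CovN.exact {d : ℕ} (hd : 1 ≤ d) {Δ : Set (Finset (Fin d))} (hΔ : IsSimplicialComplex Δ)
    {u : Fin d → ℤ} {N : ℕ} (h : CovN Δ u N) (h0 : ∀ i, 0 ≤ u i) :
    ∃ L : Multiset (Finset (Fin d)), (∀ F ∈ L, F ∈ Δ) ∧ L.card = N ∧ ∀ i, u i = mult L i := by
  obtain ⟨L, h1, h2, h3⟩ := h
  obtain ⟨L, h1, h2', h3⟩ := shrink hΔ L h1 u h0 h3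
  refine ⟨L + Multiset.replicate (N - L.card) ∅, ?_, ?_, ?_⟩
  · intro F hF
    rcases Multiset.mem_add.1 hF with hF | hF
    · exact h1 F hF
    · rw [Multiset.eq_of_mem_replicate hF]; exact empty_face hd hΔ
  · simp; omega
  · intro i
    rw [h3 i]; simp [mult]

lemma CovN.mono {d : ℕ} {Δ : Set (Finset (Fin d))} {u v : Fin d → ℤ} {N M : ℕ}
    (h : CovN Δ u N) (hv : ∀ i, v i ≤ u i) (hM : N ≤ M) : CovN Δ v M := by
  obtain ⟨L, h1, h2, h3⟩ := h
  exact ⟨L, h1, h2.trans hM, fun i => (hv i).trans (h3 i)⟩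

lemma CovN.add {d : ℕ} {Δ : Set (Finset (Fin d))} {u v : Fin d → ℤ} {N M : ℕ}
    (h : CovN Δ u N) (h' : CovN Δ v M) : CovN Δ (u + v) (N + M) := by
  obtain ⟨L, h1, h2, h3⟩ := h
  obtain ⟨L', h1', h2', h3'⟩ := h'
  refine ⟨L + L', ?_, ?_, ?_⟩
  · intro F hF
    rcases Multiset.mem_add.1 hF with hF | hF
    exacts [h1 F hF, h1' F hF]
  · simp; omega
  · intro i; have := h3 i; have := h3' i; simp; omega

/-! ### Perfect graphs and the covering property -/

lemma cl_sub {d : ℕ} {Δ : Set (Finset (Fin d))} {C C' : Finset (Fin d)} (h : Cl Δ C)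
    (hs : C' ⊆ C) : Cl Δ C' := fun i hi j hj hij => h i (hs hi) j (hs hj) hij

lemma cl_singleton {d : ℕ} {Δ : Set (Finset (Fin d))} (i : Fin d) : Cl Δ {i} := by
  intro a ha b hb hab
  simp at ha hb
  exact absurd (ha.trans hb.symm) hab

lemma perfect_cov {d : ℕ} {Δ : Set (Finset (Fin d))} (hΔ : IsSimplicialComplex Δ)
    (G : SimpleGraph (Fin d)) (hG : IsPerfectGraph G)
    (hF : ∀ F : Finset (Fin d), F ∈ Δ ↔ IsStableSet G (F : Set (Fin d))) : Cov Δ := by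
  classical
  have hcl : ∀ C : Finset (Fin d), G.IsClique (C : Set (Fin d)) → Cl Δ C := by
    intro C hC i hi j hj hij h
    rw [hF] at h
    exact h i (by simp) j (by simp) (hC hi hj hij)
  have key : ∀ (n : ℕ) (N : ℕ) (u : Fin d → ℤ), (∀ i, 0 ≤ u i) → ∑ i, u i ≤ (n : ℤ) →
    (∀ C, Cl Δ C → ∑ i ∈ C, u i ≤ (N : ℤ)) → CovN Δ u N := by
    intro n
    induction n with
    | zero =>
      intro N u h0 hs _
      refine ⟨0, by simp, by simp, fun i => ?_⟩
      have := Finset.single_le_sum (f := u) (fun j _ => h0 j) (Finset.mem_univ i)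
      simp at *; omega
    | succ n ih =>
      intro N u h0 hs hC
      by_cases hv : ∃ v, 2 ≤ u v
      · obtain ⟨v, hv⟩ := hv
        have hsv : ∑ i, (if i = v then (1 : ℤ) else 0) = 1 := by simp
        have c1 := ih N (fun i => u i - if i = v then 1 else 0)
          (by intro i; have := h0 i; split_ifs with h
              · subst h; omega
              · omega)
          (by rw [Finset.sum_sub_distrib, hsv]; push_cast at hs; linarith)
          (by intro C hc
              refine le_trans (Finset.sum_le_sum fun i _ => ?_) (hC C hc)
              split_ifs <;> omega)
        obtain ⟨L, h1, h2, h3⟩ := c1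
        obtain ⟨L, h1, h2', h3⟩ := shrink hΔ L h1 _
          (by intro i; have := h0 i; split_ifs with h
              · subst h; omega
              · omega) h3
        obtain ⟨F, hFL, hvF⟩ := mult_pos L v (by rw [← h3 v]; simp; omega)
        obtain ⟨L', rfl⟩ := Multiset.exists_cons_of_mem hFL
        rw [Multiset.card_cons] at h2'
        have hge : ∀ i, (if i ∈ F then (1 : ℤ) else 0) ≤ u i := by
          intro i
          have := h3 i
          rw [mult_cons] at this
          have := mult_nonneg L' i
          split_ifs at * <;> omega
        obtain ⟨N', rfl⟩ : ∃ N', N = N' + 1 := ⟨N - 1, by omega⟩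
        have c2 := ih N' (fun i => u i - if i ∈ F then 1 else 0)
          (by intro i; have := hge i; omega)
          (by rw [Finset.sum_sub_distrib]
              have : (1 : ℤ) ≤ ∑ i, if i ∈ F then (1 : ℤ) else 0 := by
                rw [← hsv]
                refine Finset.sum_le_sum fun i _ => ?_
                split_ifs with a b
                · omega
                · subst a; exact absurd hvF b
                · omega
                · omega
              push_cast at hs; linarith)
          (by intro C hc
              by_cases hvC : v ∈ C
              · have : (1 : ℤ) ≤ ∑ i ∈ C, if i ∈ F then (1 : ℤ) else 0 := by
                  have := Finset.single_le_sum (s := C) (f := fun i => if i ∈ F then (1 : ℤ) else 0)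
                    (fun j _ => by split_ifs <;> omega) hvC
                  simpa [hvF] using this
                have := hC C hc
                rw [Finset.sum_sub_distrib]; push_cast at *; linarith
              · have e : ∑ i ∈ C, (u i - if i ∈ F then 1 else 0) = ∑ i ∈ C, mult L' i := by
                  refine Finset.sum_congr rfl fun i hi => ?_
                  have := h3 i
                  rw [mult_cons] at this
                  have hne : i ≠ v := fun h => hvC (h ▸ hi)
                  simp only [hne, if_false] at this
                  omega
                rw [e]
                have := mult_clique hΔ (L := L') (fun F h => h1 F (by simp [h])) hc
                refine this.trans ?_
                norm_cast; omega)
        obtain ⟨L2, k1, k2, k3⟩ := c2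
        refine ⟨F ::ₘ L2, ?_, by simp; omega, ?_⟩
        · intro E hE
          rcases Multiset.mem_cons.1 hE with rfl | hE
          · exact h1 _ (by simp)
          · exact k1 E hE
        · intro i; have := k3 i; rw [mult_cons]; simp only at this; linarith
      · push Not at hv
        set s : Set (Fin d) := {i | u i = 1} with hs'
        have hcol : (G.induce s).Colorable N := by
          rw [← SimpleGraph.chromaticNumber_le_iff_colorable, hG s]
          refine iSup₂_le fun t ht => ?_
          have := hC (t.map (Function.Embedding.subtype _)) (hcl _ (by
            intro a ha b hb hab
            simp only [Finset.coe_map, Set.mem_image] at ha hb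
            obtain ⟨a', ha', rfl⟩ := ha
            obtain ⟨b', hb', rfl⟩ := hb
            have : a' ≠ b' := fun h => hab (by rw [h])
            exact ht ha' hb' this))
          rw [Finset.sum_map] at this
          have e : ∑ x ∈ t, u ((Function.Embedding.subtype (· ∈ s)) x) = t.card := by
            rw [Finset.sum_congr rfl (g := fun _ => (1 : ℤ)) (fun x _ => x.2)]; simp
          rw [e] at this
          exact_mod_cast this
        obtain ⟨c⟩ := hcol
        refine ⟨(Finset.univ : Finset (Fin N)).val.map
          (fun k => Finset.univ.filter (fun i => ∃ h : i ∈ s, c ⟨i, h⟩ = k)), ?_, by simp, ?_⟩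
        · intro F hFm
          simp only [Multiset.mem_map] at hFm
          obtain ⟨k, _, rfl⟩ := hFm
          rw [hF]
          intro i hi j hj hadj
          simp at hi hj
          obtain ⟨hi, hi'⟩ := hi
          obtain ⟨hj, hj'⟩ := hj
          exact c.valid (v := ⟨i, hi⟩) (w := ⟨j, hj⟩) hadj (hi'.trans hj'.symm)
        · intro i
          rw [mult_finset]
          by_cases hi : i ∈ s
          · have := Finset.single_le_sum (s := Finset.univ) (f := fun k => if i ∈ Finset.univ.filter
                (fun i => ∃ h : i ∈ s, c ⟨i, h⟩ = k) then (1 : ℤ) else 0)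
                (fun j _ => by split_ifs <;> omega) (Finset.mem_univ (c ⟨i, hi⟩))
            refine le_trans ?_ this
            have h1 : u i = 1 := hi
            simp [hi, h1]
          · have h1 : u i ≠ 1 := hi
            have := hv i
            refine le_trans (by omega) (Finset.sum_nonneg fun j _ => by split_ifs <;> omega)
  intro N u h0 hC
  refine key (∑ i, u i).toNat N u h0 ?_ hC
  rw [Int.toNat_of_nonneg (Finset.sum_nonneg fun i _ => h0 i)]



/-! ### Convex hulls of indicator vectors -/

lemma indicator_coe {d : ℕ} (F : Finset (Fin d)) (i : Fin d) :
    indicator (F : Set (Fin d)) i = if i ∈ F then 1 else 0 := by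
  classical
  simp [indicator, Set.indicator_apply]

lemma sum_indicator {d : ℕ} (c : Fin d → ℝ) (F : Finset (Fin d)) :
    ∑ i, c i * indicator (F : Set (Fin d)) i = ∑ i ∈ F, c i := by
  simp only [indicator_coe, mul_ite, mul_one, mul_zero, Finset.sum_ite_mem, Finset.univ_inter]

lemma exists_finset_coe {d : ℕ} (S : Set (Fin d)) : ∃ F : Finset (Fin d), (F : Set (Fin d)) = S := by
  classical
  exact ⟨S.toFinite.toFinset, by simp⟩

/-- A linear inequality valid on `A` is valid on the convex hull of `A`. -/
lemma hull_le {d : ℕ} {A : Set (Fin d → ℝ)} (c : Fin d → ℝ) (r : ℝ)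
    (h : ∀ x ∈ A, ∑ i, c i * x i ≤ r) {x : Fin d → ℝ} (hx : x ∈ convexHull ℝ A) :
    ∑ i, c i * x i ≤ r := by
  have hc : Convex ℝ {x : Fin d → ℝ | ∑ i, c i * x i ≤ r} := by
    refine convex_halfSpace_le (f := fun x : Fin d → ℝ => ∑ i, c i * x i) ⟨?_, ?_⟩ r
    · intro x y; simp [mul_add, Finset.sum_add_distrib]
    · intro a x; simp [Finset.mul_sum]; congr; ext; ring
  exact convexHull_min h hc hx

lemma mem_of_indicator_mem {d : ℕ} {A : Set (Set (Fin d))} (F : Finset (Fin d))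
    (h : indicator (F : Set (Fin d)) ∈ convexHull ℝ {x | ∃ S ∈ A, x = indicator S}) :
    (F : Set (Fin d)) ∈ A := by
  classical
  by_contra hF
  have := hull_le (fun i => if i ∈ F then (1 : ℝ) else -1) ((F.card : ℝ) - 1) ?_ h
  · rw [sum_indicator, Finset.sum_congr rfl (g := fun _ => (1 : ℝ)) (fun i hi => by simp [hi])] at this
    simp at this
    linarith
  · rintro x ⟨S, hS, rfl⟩
    obtain ⟨E, rfl⟩ := exists_finset_coe S
    rw [sum_indicator, ← Finset.sum_filter_add_sum_filter_not E (fun i => i ∈ F)]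
    have e1 : ∑ x ∈ E with x ∈ F, (if x ∈ F then (1 : ℝ) else -1) = ((E.filter (· ∈ F)).card : ℝ) := by
      rw [Finset.sum_congr rfl (g := fun _ => (1 : ℝ)) (fun i hi => by simp [(Finset.mem_filter.1 hi).2])]
      simp
    have e2 : ∑ x ∈ E with x ∉ F, (if x ∈ F then (1 : ℝ) else -1) = -((E.filter (· ∉ F)).card : ℝ) := by
      rw [Finset.sum_congr rfl (g := fun _ => (-1 : ℝ)) (fun i hi => by simp [(Finset.mem_filter.1 hi).2])]
      simp
    rw [e1, e2]
    have hsub : E.filter (· ∈ F) ⊆ F := fun i hi => (Finset.mem_filter.1 hi).2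
    have hEF : E ≠ F := fun h => hF (h ▸ hS)
    by_cases hEs : E ⊆ F
    · have hss : E.filter (· ∈ F) ⊂ F := by
        refine hsub.ssubset_of_ne fun h => hEF (hEs.antisymm ?_)
        rw [← h]; exact Finset.filter_subset _ _
      have := Finset.card_lt_card hss
      have : ((E.filter (· ∈ F)).card : ℝ) + 1 ≤ F.card := by exact_mod_cast this
      have : (0 : ℝ) ≤ ((E.filter (· ∉ F)).card : ℝ) := by positivity
      linarith
    · obtain ⟨a, ha, hb⟩ := Finset.not_subset.1 hEs
      have : 0 < (E.filter (· ∉ F)).card := Finset.card_pos.2 ⟨a, by simp [ha, hb]⟩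
      have : (1 : ℝ) ≤ ((E.filter (· ∉ F)).card : ℝ) := by exact_mod_cast this
      have := Finset.card_le_card hsub
      have : ((E.filter (· ∈ F)).card : ℝ) ≤ F.card := by exact_mod_cast this
      linarith

lemma five_to_cov {d : ℕ} {Δ : Set (Finset (Fin d))} (hΔ : IsSimplicialComplex Δ)
    (h : ∃ G : SimpleGraph (Fin d),
          IsPerfectGraph G ∧ complexPolytope Δ = stableSetPolytope G) : Cov Δ := by
  obtain ⟨G, hG, he⟩ := h
  refine perfect_cov hΔ G hG fun F => ⟨fun hF => ?_, fun hF => ?_⟩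
  · refine mem_of_indicator_mem (A := {S | IsStableSet G S}) F ?_
    have : indicator (F : Set (Fin d)) ∈ complexPolytope Δ :=
      subset_convexHull ℝ _ ⟨F, hF, rfl⟩
    rw [he] at this
    exact this
  · have h1 : indicator (F : Set (Fin d)) ∈ stableSetPolytope G :=
      subset_convexHull ℝ _ ⟨F, hF, rfl⟩
    rw [← he] at h1
    have := mem_of_indicator_mem (A := {S | ∃ F ∈ Δ, S = ((F : Finset (Fin d)) : Set (Fin d))}) F ?_
    · obtain ⟨F', h1, h2⟩ := this
      rw [Finset.coe_injective h2]; exact h1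
    · refine convexHull_mono ?_ h1
      rintro x ⟨F, hF, rfl⟩
      exact ⟨F, ⟨F, hF, rfl⟩, rfl⟩

lemma cov_to_five {d : ℕ} {Δ : Set (Finset (Fin d))} (hd : 1 ≤ d) (hΔ : IsSimplicialComplex Δ)
    (h : Cov Δ) : ∃ G : SimpleGraph (Fin d),
          IsPerfectGraph G ∧ complexPolytope Δ = stableSetPolytope G := by
  classical
  let G : SimpleGraph (Fin d) :=
    { Adj := fun i j => i ≠ j ∧ ({i, j} : Finset (Fin d)) ∉ Δ
      symm := ⟨fun i j hij => ⟨hij.1.symm, by rw [Finset.pair_comm]; exact hij.2⟩⟩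
      loopless := ⟨fun i hi => hi.1 rfl⟩ }
  have hpair : ∀ F ∈ Δ, ∀ i ∈ F, ∀ j ∈ F, ¬ G.Adj i j := by
    intro F hF i hi j hj hadj
    refine hadj.2 (hΔ.2 F hF _ ?_)
    intro x hx
    simp at hx
    rcases hx with rfl | rfl
    exacts [hi, hj]
  have hst : ∀ F : Finset (Fin d), F ∈ Δ ↔ IsStableSet G (F : Set (Fin d)) := by
    intro F
    refine ⟨fun hF i hi j hj => hpair F hF i hi j hj, fun hF => ?_⟩
    have hc := h 1 (fun i => if i ∈ F then 1 else 0) (by intro i; split_ifs <;> omega) ?_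
    · obtain ⟨L, h1, h2, h3⟩ := hc.exact hd hΔ (by intro i; split_ifs <;> omega)
      obtain ⟨E, rfl⟩ := Multiset.card_eq_one.1 h2
      refine hΔ.2 E (h1 E (by simp)) F fun i hi => ?_
      have := h3 i
      by_contra hE
      simp [hi, hE, mult] at this
    · intro C hC
      rw [Finset.sum_ite_mem, Finset.sum_const, nsmul_eq_mul, mul_one]
      norm_cast
      rw [Finset.card_le_one]
      intro a ha b hb
      by_contra hab
      rw [Finset.mem_inter] at ha hb
      exact hF a ha.2 b hb.2 ⟨hab, hC a ha.1 b hb.1 hab⟩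
  refine ⟨G, ?_, ?_⟩
  · intro s
    apply le_antisymm
    · have hfin : cliqueNumber (G.induce s) ≠ ⊤ := by
        have : cliqueNumber (G.induce s) ≤ (Fintype.card s : ℕ∞) :=
          iSup₂_le fun t _ => by exact_mod_cast Finset.card_le_univ t
        exact ne_top_of_le_ne_top (ENat.natCast_ne_top _) this
      obtain ⟨N, hN⟩ := ENat.ne_top_iff_exists.1 hfin
      rw [← hN, SimpleGraph.chromaticNumber_le_iff_colorable]
      have hc := h N (fun i => if i ∈ s then 1 else 0) (by intro i; split_ifs <;> omega) ?_
      · obtain ⟨L, h1, h2, h3⟩ := hc.exact hd hΔ (by intro i; split_ifs <;> omega)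
        obtain ⟨l, rfl⟩ := Quot.exists_rep L
        have hl : l.length = N := h2
        have hex : ∀ i : s, ∃ k : Fin N, i.1 ∈ l.get (k.cast hl.symm) := by
          rintro ⟨i, hi⟩
          have h3i : (if i ∈ s then 1 else 0) = mult (l : Multiset (Finset (Fin d))) i := h3 i
          obtain ⟨F, hF, hiF⟩ := mult_pos (l : Multiset (Finset (Fin d))) i
            (by rw [← h3i]; simp [hi])
          have hF' : F ∈ l := hF
          obtain ⟨n, hn⟩ := List.get_of_mem hF'
          exact ⟨n.cast hl, by show i ∈ l.get n; rw [hn]; exact hiF⟩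
        choose c hc using hex
        refine ⟨SimpleGraph.Coloring.mk c ?_⟩
        intro i j hij he
        have a := hc i
        have b := hc j
        rw [← he] at b
        exact hpair _ (h1 _ (by exact List.get_mem _ _)) _ a _ b hij
      · intro C hC
        have hle : (((C.filter (· ∈ s)).subtype (· ∈ s)).card : ℕ∞) ≤ cliqueNumber (G.induce s) := by
          refine le_iSup₂_of_le _ ?_ le_rfl
          intro a ha b hb hab
          simp at ha hb
          have : (a : Fin d) ≠ b := fun h => hab (Subtype.ext h)
          exact ⟨this, hC a ha b hb this⟩
        rw [← hN, Finset.card_subtype, Finset.filter_filter] at hle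
        rw [Finset.sum_ite, Finset.sum_const, Finset.sum_const_zero]
        simp at hle ⊢
        exact_mod_cast hle
    · exact iSup₂_le fun t ht => ht.card_le_chromaticNumber
  · unfold complexPolytope stableSetPolytope
    congr 1
    ext x
    constructor
    · rintro ⟨F, hF, rfl⟩; exact ⟨F, (hst F).1 hF, rfl⟩
    · rintro ⟨S, hS, rfl⟩
      obtain ⟨E, rfl⟩ := exists_finset_coe S
      exact ⟨E, (hst E).2 hS, rfl⟩

lemma mem_dual {d : ℕ} {Δ : Set (Finset (Fin d))} (P : PartialOrder (Fin d)) (x : Fin d → ℝ) :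
    x ∈ dualPolytope (gammaPolytope (orderPolytope P) (complexPolytope Δ)) ↔
      (∀ I : Finset (Fin d), IsPosetIdeal P (I : Set (Fin d)) → ∑ i ∈ I, x i ≤ 1) ∧
      ∀ F ∈ Δ, - ∑ i ∈ F, x i ≤ 1 := by
  constructor
  · intro h
    constructor
    · intro I hI
      rw [← sum_indicator]
      exact h _ (subset_convexHull ℝ _ (Or.inl (subset_convexHull ℝ _ ⟨I, hI, rfl⟩)))
    · intro F hF
      rw [← sum_indicator]
      have := h (-indicator (F : Set (Fin d))) (subset_convexHull ℝ _ (Or.inr (by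
        rw [Set.mem_neg, neg_neg]
        exact (subset_convexHull ℝ _ ⟨F, hF, rfl⟩))))
      simpa using this
  · rintro ⟨h1, h2⟩ y hy
    refine hull_le x 1 ?_ hy
    rintro y (hy | hy)
    · refine hull_le x 1 ?_ hy
      rintro y ⟨I, hI, rfl⟩
      obtain ⟨E, rfl⟩ := exists_finset_coe I
      rw [sum_indicator]; exact h1 E hI
    · have := hull_le (-x) 1 ?_ hy
      · simpa using this
      · rintro y ⟨F, hF, rfl⟩
        rw [sum_indicator]; simpa using h2 F hF

lemma omega_le {d : ℕ} {Δ : Set (Finset (Fin d))} (P : PartialOrder (Fin d)) (c : Fin d → ℝ)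
    (s r : ℝ) (h1 : ∀ I : Finset (Fin d), IsPosetIdeal P (I : Set (Fin d)) → ∑ i ∈ I, c i + s ≤ r)
    (h2 : ∀ F ∈ Δ, - ∑ i ∈ F, c i - s ≤ r) (y : Fin (d+1) → ℝ)
    (hy : y ∈ omegaPolytope (orderPolytope P) (complexPolytope Δ)) :
    ∑ i, c i * y i.castSucc + s * y (Fin.last d) ≤ r := by
  have := hull_le (Fin.snoc (α := fun _ => ℝ) c s) r ?_ hy
  · simpa [Fin.sum_univ_castSucc] using this
  · rintro _ (⟨z, hz, rfl⟩ | ⟨z, hz, rfl⟩)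
    · have := hull_le c (r - s) ?_ hz
      · simp [Fin.sum_univ_castSucc]; linarith
      · rintro y ⟨I, hI, rfl⟩
        obtain ⟨E, rfl⟩ := exists_finset_coe I
        rw [sum_indicator]; linarith [h1 E hI]
    · have := hull_le (-c) (r + s) ?_ hz
      · simp at this
        simp [Fin.sum_univ_castSucc]; linarith
      · rintro y ⟨F, hF, rfl⟩
        rw [sum_indicator]; simp; linarith [h2 F hF]



/-! ### Integer-valued sublinear functions -/

/-- Integer-valued sublinear functions (homogeneity is only required for doubling). -/
def Sub {d : ℕ} (f : (Fin d → ℤ) → ℤ) : Prop :=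
  (∀ u v, f (u + v) ≤ f u + f v) ∧ ∀ u, 2 * f u ≤ f (u + u)

lemma Sub.zero {d : ℕ} {f : (Fin d → ℤ) → ℤ} (h : Sub f) : f 0 = 0 := by
  have a := h.1 0 0
  have b := h.2 0
  simp at a b; omega

lemma Sub.le_nsmul {d : ℕ} {f : (Fin d → ℤ) → ℤ} (h : Sub f) (n : ℕ) (u : Fin d → ℤ) :
    f (n • u) ≤ n * f u := by
  induction n with
  | zero => simp [h.zero]
  | succ n ih =>
    rw [succ_nsmul]
    have := h.1 (n • u) u
    push_cast; linarith

lemma Sub.pow {d : ℕ} {f : (Fin d → ℤ) → ℤ} (h : Sub f) (n : ℕ) (u : Fin d → ℤ) :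
    2 ^ n * f u ≤ f ((2 ^ n : ℕ) • u) := by
  induction n with
  | zero => simp
  | succ n ih =>
    have := h.2 ((2 ^ n : ℕ) • u)
    rw [← add_nsmul, ← mul_two, ← pow_succ] at this
    rw [pow_succ]; linarith

lemma Sub.nsmul {d : ℕ} {f : (Fin d → ℤ) → ℤ} (h : Sub f) (n : ℕ) (u : Fin d → ℤ) :
    n * f u ≤ f (n • u) := by
  have hn : n ≤ 2 ^ n := Nat.lt_two_pow_self.le
  obtain ⟨r, hr⟩ := Nat.exists_eq_add_of_le hn
  have a := h.pow n u
  have b := h.1 (n • u) (r • u)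
  have c := h.le_nsmul r u
  rw [← add_nsmul, ← hr] at b
  have e : (2 : ℤ) ^ n = n + r := by exact_mod_cast hr
  rw [e, add_mul] at a
  linarith

lemma Sub.deriv {d : ℕ} {f : (Fin d → ℤ) → ℤ} (h : Sub f) (w : Fin d → ℤ) :
    ∃ g : (Fin d → ℤ) → ℤ, Sub g ∧ (∀ u, g u ≤ f u) ∧ g (-w) ≤ - f w := by
  have hex : ∀ u, ∃ m : ℤ, (∀ n : ℕ, m ≤ f (n • w + u) - n * f w) ∧
      ∃ n : ℕ, m = f (n • w + u) - n * f w := by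
    intro u
    obtain ⟨m, ⟨n, hn⟩, hm⟩ := Int.exists_least_of_bdd
      (P := fun m => ∃ n : ℕ, m = f (n • w + u) - n * f w) ⟨- f (-u), by
        rintro z ⟨n, rfl⟩
        have a := h.nsmul n w
        have b := h.1 (n • w + u) (-u)
        rw [add_neg_cancel_right] at b
        linarith⟩ ⟨_, 0, rfl⟩
    exact ⟨m, fun k => hm _ ⟨k, rfl⟩, n, hn⟩
  choose g hg hg' using hex
  refine ⟨g, ⟨?_, ?_⟩, ?_, ?_⟩
  · intro u v
    obtain ⟨n, hn⟩ := hg' u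
    obtain ⟨k, hk⟩ := hg' v
    have a := hg (u + v) (n + k)
    have b := h.1 (n • w + u) (k • w + v)
    have e : (n + k) • w + (u + v) = n • w + u + (k • w + v) := by rw [add_nsmul]; abel
    rw [e] at a
    push_cast at a
    linarith
  · intro u
    obtain ⟨n, hn⟩ := hg' (u + u)
    have a := hg u n
    have b := h.1 (n • w) (n • w + (u + u))
    have c := h.2 (n • w + u)
    have e : n • w + u + (n • w + u) = n • w + (n • w + (u + u)) := by abel
    rw [e] at c
    have := h.le_nsmul n w
    linarith
  · intro u
    have := hg u 0
    simpa using this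
  · have := hg (-w) 1
    simpa [h.zero] using this

lemma Sub.support {d : ℕ} {f : (Fin d → ℤ) → ℤ} (h : Sub f) (w : Fin d → ℤ) :
    ∃ y : Fin d → ℤ, (∀ u, ∑ i, y i * u i ≤ f u) ∧ f w ≤ ∑ i, y i * w i := by
  have key : ∀ s : Finset (Fin d), ∃ g : (Fin d → ℤ) → ℤ, Sub g ∧ (∀ u, g u ≤ f u) ∧
      g (-w) ≤ - f w ∧ ∀ i ∈ s, g (-Pi.single i 1) ≤ - g (Pi.single i 1) := by
    intro s
    induction s using Finset.induction with
    | empty =>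
      obtain ⟨g, h1, h2, h3⟩ := h.deriv w
      exact ⟨g, h1, h2, h3, by simp⟩
    | insert a s ha ih =>
      obtain ⟨g, h1, h2, h3, h4⟩ := ih
      obtain ⟨k, k1, k2, k3⟩ := h1.deriv (Pi.single a 1)
      refine ⟨k, k1, fun u => (k2 u).trans (h2 u), (k2 _).trans h3, ?_⟩
      intro i hi
      rcases Finset.mem_insert.1 hi with rfl | hi
      · exact k3.trans (neg_le_neg (k2 _))
      · exact ((k2 _).trans (h4 i hi)).trans (neg_le_neg (k2 _))
  obtain ⟨g, h1, h2, h3, h4⟩ := key Finset.univ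
  have hs : ∀ (s : Finset (Fin d)) (v : Fin d → Fin d → ℤ), g (∑ i ∈ s, v i) ≤ ∑ i ∈ s, g (v i) := by
    intro s v
    induction s using Finset.induction with
    | empty => simp [h1.zero]
    | insert a s ha ih =>
      rw [Finset.sum_insert ha, Finset.sum_insert ha]
      exact (h1.1 _ _).trans (by linarith)
  have hle : ∀ u : Fin d → ℤ, g u ≤ ∑ i, g (Pi.single i 1) * u i := by
    intro u
    have e : u = ∑ i, u i • (Pi.single i 1 : Fin d → ℤ) := by
      ext j; simp [Finset.sum_apply, Pi.single_apply]
    calc g u = g (∑ i, u i • (Pi.single i 1 : Fin d → ℤ)) := by rw [← e]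
      _ ≤ ∑ i, g (u i • (Pi.single i 1 : Fin d → ℤ)) := hs _ _
      _ ≤ _ := Finset.sum_le_sum fun i _ => ?_
    obtain ⟨n, hn | hn⟩ := Int.eq_nat_or_neg (u i)
    · rw [hn, natCast_zsmul]
      have := h1.le_nsmul n (Pi.single i 1)
      linarith
    · rw [hn, neg_smul, natCast_zsmul, ← smul_neg]
      have := h1.le_nsmul n (-Pi.single i 1)
      have h5 := h4 i (Finset.mem_univ i)
      have : (n : ℤ) * g (-Pi.single i 1) ≤ n * (- g (Pi.single i 1)) :=
        mul_le_mul_of_nonneg_left h5 (by positivity)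
      linarith
  refine ⟨fun i => g (Pi.single i 1), fun u => ?_, ?_⟩
  · have a := hle (-u)
    have b := h1.1 u (-u)
    rw [add_neg_cancel, h1.zero] at b
    have c := h2 u
    simp at a
    linarith
  · have a := hle w
    have b := h1.1 w (-w)
    rw [add_neg_cancel, h1.zero] at b
    linarith

lemma exists_covN {d : ℕ} {Δ : Set (Finset (Fin d))} (hΔ : IsSimplicialComplex Δ)
    (u : Fin d → ℤ) : ∃ N, CovN Δ u N := by
  classical
  refine ⟨_, (∑ i, (u i).toNat) • ((Finset.univ : Finset (Fin d)).val.map fun i => {i}),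
    ?_, le_rfl, fun i => ?_⟩
  · intro F hF
    have := Multiset.mem_of_mem_nsmul hF
    simp at this
    obtain ⟨i, rfl⟩ := this
    exact hΔ.1 i
  · rw [mult_nsmul, mult_finset]
    simp
    have := Finset.single_le_sum (f := fun i => ((u i).toNat : ℤ)) (fun j _ => by positivity)
      (Finset.mem_univ i)
    have h2 := Int.self_le_toNat (u i)
    simp at this h2 ⊢
    grind

lemma halving_to_cov {d : ℕ} {Δ : Set (Finset (Fin d))} (hΔ : IsSimplicialComplex Δ)
    (H : ∀ (u : Fin d → ℤ) (b : ℕ), (∀ i, 0 ≤ u i) → CovN Δ (u + u) (2 * b + 1) → CovN Δ u b) :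
    Cov Δ := by
  classical
  have H' : ∀ (u : Fin d → ℤ) (b : ℕ), CovN Δ (u + u) (2 * b + 1) → CovN Δ u b := by
    intro u b hu
    refine (H (fun i => max (u i) 0) b (fun i => le_max_right _ _) ?_).mono
      (fun i => le_max_left _ _) le_rfl
    obtain ⟨L, h1, h2, h3⟩ := hu
    refine ⟨L, h1, h2, fun i => ?_⟩
    have := h3 i
    have := mult_nonneg L i
    simp at *
    omega
  have hex := exists_covN hΔ
  let f : (Fin d → ℤ) → ℤ := fun u => (Nat.find (hex u) : ℤ)
  have hf : ∀ u, CovN Δ u (Nat.find (hex u)) := fun u => Nat.find_spec (hex u)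
  have hmin : ∀ u N, CovN Δ u N → f u ≤ N := fun u N h =>
    Int.ofNat_le.2 (Nat.find_min' (hex u) h)
  have hS : Sub f := by
    constructor
    · intro u v
      exact_mod_cast hmin _ _ ((hf u).add (hf v))
    · intro u
      set n := Nat.find (hex (u + u)) with hn
      have h1 : CovN Δ u (n / 2) := H' u _ ((hf (u + u)).mono (fun _ => le_rfl) (by omega))
      have := hmin _ _ h1
      change 2 * f u ≤ (n : ℤ)
      omega
  intro N u h0 hC
  obtain ⟨y, hy, hyu⟩ := hS.support u
  have hface : ∀ F ∈ Δ, ∑ i ∈ F, y i ≤ 1 := by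
    intro F hF
    have := hy (fun i => if i ∈ F then 1 else 0)
    simp at this
    refine this.trans ?_
    have := hmin (fun i => if i ∈ F then 1 else 0) 1 ⟨{F}, by simpa using hF, by simp, by simp [mult]⟩
    exact_mod_cast this
  have hpos : ∀ i, 0 ≤ y i := by
    intro i
    have := hy (-Pi.single i 1)
    have h2 := hmin (-Pi.single i 1) 0 ⟨0, by simp, by simp, by
      intro j; simp [Pi.single_apply]; split_ifs <;> omega⟩
    simp [Pi.single_apply] at this
    simp at h2
    omega
  have hone : ∀ i, y i ≤ 1 := fun i => by simpa using hface _ (hΔ.1 i)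
  have hcl : Cl Δ (Finset.univ.filter fun i => y i = 1) := by
    intro i hi j hj hij hF
    have := hface _ hF
    rw [Finset.sum_pair hij] at this
    simp at hi hj
    omega
  have hsum := hC _ hcl
  rw [Finset.sum_filter] at hsum
  have : f u ≤ N := by
    refine hyu.trans (le_trans (Finset.sum_le_sum fun i _ => ?_) hsum)
    have := hpos i
    have := hone i
    have : y i = 0 ∨ y i = 1 := by omega
    rcases this with h | h <;> simp [h]
  exact (hf u).mono (fun _ => le_rfl) (Int.ofNat_le.1 this)



/-! ### The integer decomposition property -/

lemma multiset_sum_mem {E : Type*} [AddCommGroup E] [Module ℝ E] {K : Set E} (hK : Convex ℝ K)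
    (hne : K.Nonempty) (T : Multiset E) (hT : ∀ x ∈ T, x ∈ K) : T.sum ∈ (T.card : ℝ) • K := by
  induction T using Multiset.induction with
  | empty => simp [Set.zero_smul_set hne]
  | cons x T ih =>
    have h1 := ih fun y hy => hT y (by simp [hy])
    rw [Multiset.sum_cons, Multiset.card_cons]
    push_cast
    rw [add_comm (T.card : ℝ), hK.add_smul (by norm_num) (by positivity), one_smul]
    exact Set.add_mem_add (hT x (by simp)) h1

/-- The vertex of `Ω` corresponding to a poset ideal. -/
noncomputable def up {d : ℕ} (I : Finset (Fin d)) : Fin (d+1) → ℝ :=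
  Fin.snoc (α := fun _ => ℝ) (indicator (I : Set (Fin d))) 1

/-- The vertex of `Ω` corresponding to a face. -/
noncomputable def dn {d : ℕ} (F : Finset (Fin d)) : Fin (d+1) → ℝ :=
  Fin.snoc (α := fun _ => ℝ) (-indicator (F : Set (Fin d))) (-1)

lemma up_mem {d : ℕ} {Δ : Set (Finset (Fin d))} (P : PartialOrder (Fin d)) {I : Finset (Fin d)}
    (hI : IsPosetIdeal P (I : Set (Fin d))) :
    up I ∈ omegaPolytope (orderPolytope P) (complexPolytope Δ) :=
  subset_convexHull ℝ _ (Or.inl ⟨_, subset_convexHull ℝ _ ⟨I, hI, rfl⟩, rfl⟩)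

lemma dn_mem {d : ℕ} {Δ : Set (Finset (Fin d))} (P : PartialOrder (Fin d)) {F : Finset (Fin d)}
    (hF : F ∈ Δ) : dn F ∈ omegaPolytope (orderPolytope P) (complexPolytope Δ) := by
  refine subset_convexHull ℝ _ (Or.inr ⟨_, ?_, rfl⟩)
  rw [Set.mem_neg, neg_neg]
  exact subset_convexHull ℝ _ ⟨F, hF, rfl⟩

lemma up_sum_castSucc {d : ℕ} (L : Multiset (Finset (Fin d))) (i : Fin d) :
    (L.map up).sum i.castSucc = (mult L i : ℝ) := by
  induction L using Multiset.induction with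
  | empty => simp
  | cons F L ih =>
    rw [Multiset.map_cons, Multiset.sum_cons, Pi.add_apply, ih, mult_cons]
    simp only [up, Fin.snoc_castSucc, indicator_coe]
    push_cast; rfl

lemma up_sum_last {d : ℕ} (L : Multiset (Finset (Fin d))) :
    (L.map up).sum (Fin.last d) = (L.card : ℝ) := by
  induction L using Multiset.induction with
  | empty => simp
  | cons F L ih =>
    rw [Multiset.map_cons, Multiset.sum_cons, Pi.add_apply, ih, Multiset.card_cons]
    simp [up]; ring

lemma dn_sum_castSucc {d : ℕ} (L : Multiset (Finset (Fin d))) (i : Fin d) :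
    (L.map dn).sum i.castSucc = -(mult L i : ℝ) := by
  induction L using Multiset.induction with
  | empty => simp
  | cons F L ih =>
    rw [Multiset.map_cons, Multiset.sum_cons, Pi.add_apply, ih, mult_cons]
    simp only [dn, Fin.snoc_castSucc, Pi.neg_apply, indicator_coe]
    push_cast; ring

lemma dn_sum_last {d : ℕ} (L : Multiset (Finset (Fin d))) :
    (L.map dn).sum (Fin.last d) = -(L.card : ℝ) := by
  induction L using Multiset.induction with
  | empty => simp
  | cons F L ih =>
    rw [Multiset.map_cons, Multiset.sum_cons, Pi.add_apply, ih, Multiset.card_cons]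
    simp [dn]

lemma empty_ideal {d : ℕ} (P : PartialOrder (Fin d)) :
    IsPosetIdeal P ((∅ : Finset (Fin d)) : Set (Fin d)) := by
  intro i hi; simp at hi

lemma idp_to_cov {d : ℕ} (hd : 1 ≤ d) {Δ : Set (Finset (Fin d))} (hΔ : IsSimplicialComplex Δ)
    (P : PartialOrder (Fin d))
    (h : HasIDP (omegaPolytope (orderPolytope P) (complexPolytope Δ))) : Cov Δ := by
  classical
  refine halving_to_cov hΔ fun u b h0 hu => ?_
  obtain ⟨L, h1, h2, h3⟩ := hu.exact hd hΔ (fun i => by have := h0 i; simp; omega)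
  set Ω := omegaPolytope (orderPolytope P) (complexPolytope Δ) with hΩ
  have hmem := multiset_sum_mem (K := Ω) (convex_convexHull ℝ _) ⟨_, up_mem P (empty_ideal P)⟩
    (up ∅ ::ₘ L.map dn) (by
      intro x hx
      rcases Multiset.mem_cons.1 hx with rfl | hx
      · exact up_mem P (empty_ideal P)
      · obtain ⟨F, hF, rfl⟩ := Multiset.mem_map.1 hx
        exact dn_mem P (h1 F hF))
  rw [Multiset.card_cons, Multiset.card_map, h2] at hmem
  obtain ⟨y, hy, hye⟩ := hmem
  have hye' : ∀ j, (2 * (b : ℝ) + 2) * y j = up ∅ j + (L.map dn).sum j := by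
    intro j
    have := congrFun hye j
    simp at this
    rw [← this]; ring
  obtain ⟨f, hf, hfa⟩ := h (b + 1) (by omega)
    (Fin.snoc (α := fun _ => ℝ) (fun i => -(u i : ℝ)) (-(b : ℝ))) (by
      intro i
      refine Fin.lastCases ?_ (fun i => ?_) i
      · exact ⟨-b, by simp⟩
      · exact ⟨-u i, by simp⟩) (by
      refine ⟨y, hy, ?_⟩
      ext j
      simp only [Pi.smul_apply, smul_eq_mul]
      have := hye' j
      revert this
      refine Fin.lastCases ?_ (fun i => ?_) j
      · rw [dn_sum_last, h2]
        simp [up]; intro h; linarith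
      · rw [dn_sum_castSucc, ← h3]
        simp [up]; intro h
        have : indicator (∅ : Set (Fin d)) i = 0 := by simp [indicator]
        linarith)
  choose z hz using fun k => (hf k).2
  have hlast : ∀ k, -1 ≤ z k (Fin.last d) := by
    intro k
    have := omega_le P (fun _ => 0) (-1) 1 (by intros; simp) (by intros; simp) (f k) (hf k).1
    rw [hz] at this
    simp at this
    have : (-1 : ℝ) ≤ z k (Fin.last d) := by linarith
    exact_mod_cast this
  have hco : ∀ k i, z k (Fin.last d) - 1 ≤ 2 * z k (Fin.castSucc i) := by
    intro k i
    have := omega_le P (fun j => if j = i then -1 else 0) (1/2) (1/2)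
      (by
        intro I _
        rw [Finset.sum_ite_eq']
        split_ifs <;> norm_num) (by
        intro I _
        rw [Finset.sum_ite_eq']
        split_ifs <;> norm_num) (f k) (hf k).1
    simp only [ite_mul, zero_mul, Finset.sum_ite_eq', Finset.mem_univ, if_true] at this
    rw [hz, hz] at this
    have : (z k (Fin.last d) : ℝ) - 1 ≤ 2 * z k (Fin.castSucc i) := by linarith
    exact_mod_cast this
  let F : Fin (b + 1) → Finset (Fin d) := fun k =>
    if z k (Fin.last d) = -1 then Finset.univ.filter (fun i => z k (Fin.castSucc i) = -1) else ∅
  have hF : ∀ k, F k ∈ Δ := by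
    intro k
    by_cases hk : z k (Fin.last d) = -1
    · by_contra hn
      have := omega_le P (fun j => if j ∈ F k then -1 else 0) (((F k).card - 1 : ℝ)/2)
        (((F k).card - 1 : ℝ)/2)
        (by
          intro I _
          have : ∑ i ∈ I, (if i ∈ F k then (-1 : ℝ) else 0) ≤ 0 :=
            Finset.sum_nonpos fun i _ => by split_ifs <;> norm_num
          linarith) (by
          intro I hI
          rw [Finset.sum_ite_mem, Finset.sum_const]
          have : (I ∩ F k).card < (F k).card := by
            refine Finset.card_lt_card (Finset.inter_subset_right.ssubset_of_ne fun he => hn ?_)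
            refine hΔ.2 I hI _ ?_
            rw [← he]; exact Finset.inter_subset_left
          have : ((I ∩ F k).card : ℝ) + 1 ≤ (F k).card := by exact_mod_cast this
          simp; linarith) (f k) (hf k).1
      simp only [ite_mul, zero_mul] at this
      rw [Finset.sum_ite_mem, Finset.univ_inter, Finset.sum_congr rfl (g := fun _ => (1 : ℝ)), hz, hk] at this
      · simp at this
        linarith
      · intro i hi
        simp only [F, hk, if_true, Finset.mem_filter] at hi
        rw [hz, hi.2]; norm_num
    · simp only [F, hk, if_false]
      exact empty_face hd hΔ
  have hle : ∀ k i, - z k (Fin.castSucc i) ≤ if i ∈ F k then 1 else 0 := by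
    intro k i
    have a := hlast k
    have b := hco k i
    by_cases hk : z k (Fin.last d) = -1
    · by_cases hi : z k (Fin.castSucc i) = -1
      · simp [F, hk, hi]
      · simp [F, hk, hi]; omega
    · simp [F, hk]; omega
  have hsum : ∀ j, (Fin.snoc (α := fun _ => ℝ) (fun i => -(u i : ℝ)) (-(b : ℝ)) : Fin (d+1) → ℝ) j
      = ∑ k, (z k j : ℝ) := by
    intro j
    rw [hfa, Finset.sum_apply]
    exact Finset.sum_congr rfl fun k _ => hz k j
  have hsl : -(b : ℤ) = ∑ k, z k (Fin.last d) := by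
    have := hsum (Fin.last d)
    simp at this
    exact_mod_cast this
  have hsc : ∀ i, - u i = ∑ k, z k (Fin.castSucc i) := by
    intro i
    have := hsum (Fin.castSucc i)
    simp at this
    exact_mod_cast this
  obtain ⟨k0, hk0⟩ : ∃ k, z k (Fin.last d) ≠ -1 := by
    by_contra hcon
    push Not at hcon
    simp [hcon] at hsl
  refine ⟨(Finset.univ.erase k0).val.map F, ?_, ?_, ?_⟩
  · intro E hE
    obtain ⟨k, _, rfl⟩ := Multiset.mem_map.1 hE
    exact hF k
  · rw [Multiset.card_map, Finset.card_val, Finset.card_erase_of_mem (Finset.mem_univ _)]; simp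
  · intro i
    rw [mult_finset]
    have h5 := hsc i
    rw [← Finset.add_sum_erase _ _ (Finset.mem_univ k0)] at h5
    have h6 : ∑ k ∈ Finset.univ.erase k0, - z k (Fin.castSucc i) ≤
      ∑ k ∈ Finset.univ.erase k0, if i ∈ F k then (1 : ℤ) else 0 :=
      Finset.sum_le_sum fun k _ => hle k i
    have h7 := hle k0 i
    have h8 : i ∉ F k0 := by simp [F, hk0]
    rw [if_neg h8] at h7
    rw [Finset.sum_neg_distrib] at h6
    linarith

lemma push_up {d : ℕ} (P : PartialOrder (Fin d)) (c : Fin d → ℤ) :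
    ∃ (M : Fin d → ℤ) (g : Fin d → Fin d → ℤ), (∀ j, 0 ≤ M j) ∧ (∀ j, c j ≤ M j) ∧
      (∀ i j, P.le i j → M j ≤ M i) ∧ (∀ j, ∑ i, g j i * c i = M j) ∧ (∀ j i, 0 ≤ g j i) ∧
      ∀ j (I : Finset (Fin d)), IsPosetIdeal P (I : Set (Fin d)) →
        ∑ i ∈ I, g j i ≤ if j ∈ I then 1 else 0 := by
  classical
  have hex : ∀ j, ∃ i, P.le j i ∧ ∀ k, P.le j k → c k ≤ c i := by
    intro j
    obtain ⟨i, hi, h⟩ := Finset.exists_max_image (Finset.univ.filter fun i => P.le j i) c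
      ⟨j, by simp⟩
    exact ⟨i, by simpa using hi, fun k hk => h k (by simpa using hk)⟩
  choose m hm hmax using hex
  refine ⟨fun j => max 0 (c (m j)), fun j i => if 0 ≤ c (m j) ∧ i = m j then 1 else 0,
    fun j => le_max_left _ _, fun j => le_max_of_le_right (hmax j j (P.le_refl j)),
    fun i j hij => max_le_max le_rfl (hmax i _ (P.le_trans _ _ _ hij (hm j))), ?_, ?_, ?_⟩
  · intro j
    by_cases h : 0 ≤ c (m j)
    · simp [h]
    · simp [h]; omega
  · intro j i; dsimp only; split_ifs <;> omega
  · intro j I hI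
    by_cases h : 0 ≤ c (m j)
    · simp only [h, true_and]
      rw [Finset.sum_ite_eq']
      by_cases hj : m j ∈ I
      · have : j ∈ I := hI _ hj _ (hm j)
        simp [this, hj]
      · simp only [hj, if_false]; split_ifs <;> omega
    · simp [h]; split_ifs <;> omega

/-- The level sets of an antitone function decompose it into poset ideals. -/
lemma layers {d : ℕ} (P : PartialOrder (Fin d)) (M : Fin d → ℤ) (h0 : ∀ j, 0 ≤ M j)
    (hM : ∀ i j, P.le i j → M j ≤ M i) (N : ℕ) (hN : ∀ j, M j ≤ N) :
    ∃ L : Multiset (Finset (Fin d)), (∀ I ∈ L, IsPosetIdeal P (I : Set (Fin d))) ∧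
      L.card = N ∧ ∀ i, M i = mult L i := by
  refine ⟨(Finset.range N).val.map fun k : ℕ => Finset.univ.filter fun i => (k : ℤ) < M i, ?_, ?_, ?_⟩
  · intro I hI
    obtain ⟨k, _, rfl⟩ := Multiset.mem_map.1 hI
    intro i hi j hj
    simp at hi ⊢
    exact hi.trans_le (hM _ _ hj)
  · simp
  · intro i
    rw [mult_finset]
    simp only [Finset.mem_filter, Finset.mem_univ, true_and]
    rw [← Finset.sum_filter, Finset.sum_const]
    have : (Finset.range N).filter (fun k : ℕ => (k : ℤ) < M i) = Finset.range (M i).toNat := by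
      ext k
      have := hN i
      have := h0 i
      simp; omega
    rw [this]
    have := h0 i
    simp; omega

lemma cov_to_idp {d : ℕ} (hd : 1 ≤ d) {Δ : Set (Finset (Fin d))} (hΔ : IsSimplicialComplex Δ)
    (hcov : Cov Δ) (P : PartialOrder (Fin d)) :
    HasIDP (omegaPolytope (orderPolytope P) (complexPolytope Δ)) := by
  classical
  intro m hm a ha hmem
  choose z hz using ha
  set Ω := omegaPolytope (orderPolytope P) (complexPolytope Δ) with hΩ
  obtain ⟨y, hy, hya⟩ := hmem
  have hya : ∀ j, (m : ℝ) * y j = z j := fun j => by rw [← hz, ← hya]; rfl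
  have hm' : (0 : ℝ) < m := by exact_mod_cast hm
  -- integral version of the inequalities of `Ω`, scaled by `2 m`
  have hle : ∀ (c : Fin d → ℤ) (s r : ℤ),
      (∀ I : Finset (Fin d), IsPosetIdeal P (I : Set (Fin d)) → 2 * ∑ i ∈ I, c i + s ≤ r) →
      (∀ F ∈ Δ, - (2 * ∑ i ∈ F, c i) - s ≤ r) →
      2 * ∑ i, c i * z (Fin.castSucc i) + s * z (Fin.last d) ≤ m * r := by
    intro c s r h1 h2
    have := omega_le (Δ := Δ) P (fun i => 2 * (c i : ℝ)) s r
      (by intro I hI; rw [← Finset.mul_sum]; exact_mod_cast h1 I hI)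
      (by intro I hI; rw [← Finset.mul_sum]; exact_mod_cast h2 I hI) y hy
    have := mul_le_mul_of_nonneg_left this hm'.le
    rw [mul_add, Finset.mul_sum] at this
    have e : ∀ i, (m : ℝ) * (2 * (c i : ℝ) * y (Fin.castSucc i)) = 2 * (c i * z (Fin.castSucc i)) := by
      intro i; rw [← hya]; ring
    simp only [e] at this
    rw [← Finset.mul_sum, show (m : ℝ) * (s * y (Fin.last d)) = s * z (Fin.last d) by
      rw [← hya]; ring] at this
    exact_mod_cast this
  set t := z (Fin.last d) with ht
  have ht1 : t ≤ m := by
    have := hle 0 1 1 (by simp) (by simp)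
    simpa using this
  have ht2 : -t ≤ m := by
    have := hle 0 (-1) 1 (by simp) (by simp)
    simpa using this
  obtain ⟨M, g, hM0, hMc, hMa, hMg, hg0, hgI⟩ := push_up P (fun i => z (Fin.castSucc i))
  have hMle : ∀ j, 2 * M j ≤ m + t := by
    intro j
    have := hle (g j) (-1) 1 (by
      intro I hI
      have := hgI j I hI
      split_ifs at this <;> omega) (by
      intro F hF
      have : 0 ≤ ∑ i ∈ F, g j i := Finset.sum_nonneg fun i _ => hg0 j i
      omega)
    rw [hMg] at this
    linarith
  have hwle : ∀ C, Cl Δ C → 2 * ∑ j ∈ C, (M j - z (Fin.castSucc j)) ≤ m - t := by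
    intro C hC
    have hsw : ∀ I : Finset (Fin d), ∑ i ∈ I, ∑ j ∈ C, (g j i - if i = j then 1 else 0) =
        ∑ j ∈ C, (∑ i ∈ I, g j i - if j ∈ I then 1 else 0) := by
      intro I
      rw [Finset.sum_comm]
      refine Finset.sum_congr rfl fun j _ => ?_
      rw [Finset.sum_sub_distrib, Finset.sum_ite_eq']
    have := hle (fun i => ∑ j ∈ C, (g j i - if i = j then 1 else 0)) 1 1 (by
      intro I hI
      rw [hsw]
      have : ∑ j ∈ C, (∑ i ∈ I, g j i - if j ∈ I then 1 else 0) ≤ 0 :=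
        Finset.sum_nonpos fun j _ => by have := hgI j I hI; linarith
      linarith) (by
      intro F hF
      rw [hsw, Finset.sum_sub_distrib]
      have h1 := face_clique hΔ hF hC
      have : 0 ≤ ∑ j ∈ C, ∑ i ∈ F, g j i :=
        Finset.sum_nonneg fun j _ => Finset.sum_nonneg fun i _ => hg0 j i
      linarith)
    have e : ∑ i, (∑ j ∈ C, (g j i - if i = j then 1 else 0)) * z (Fin.castSucc i) =
        ∑ j ∈ C, (M j - z (Fin.castSucc j)) := by
      simp only [Finset.sum_mul]
      rw [Finset.sum_comm]
      refine Finset.sum_congr rfl fun j _ => ?_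
      simp only [sub_mul, Finset.sum_sub_distrib]
      rw [hMg]; simp
    rw [e] at this
    linarith
  set A := ((m + t) / 2).toNat with hA
  set B := ((m - t) / 2).toNat with hB
  obtain ⟨L1, a1, a2, a3⟩ := layers P M hM0 hMa A (fun j => by have := hMle j; omega)
  obtain ⟨L2, b1, b2, b3⟩ := (hcov B (fun j => M j - z (Fin.castSucc j))
    (fun j => by have := hMc j; omega) (fun C hC => by have := hwle C hC; omega)).exact hd hΔ
    (fun j => by have := hMc j; omega)
  have h0Ω : (0 : Fin (d+1) → ℝ) ∈ Ω := by
    have h := (convex_convexHull ℝ _ : Convex ℝ Ω) (up_mem P (empty_ideal P))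
      (dn_mem P (empty_face hd hΔ)) (a := 1/2) (b := 1/2) (by norm_num) (by norm_num) (by norm_num)
    refine (congrArg (· ∈ Ω) ?_).mp h
    ext j
    refine Fin.lastCases ?_ (fun i => ?_) j
    · simp [up, dn]
    · simp [up, dn]
  set T : Multiset (Fin (d+1) → ℝ) := L1.map up + L2.map dn + Multiset.replicate (m - (A + B)) 0 with hT
  have hTc : T.card = m := by
    simp [hT, a2, b2]; omega
  have hTs : T.sum = a := by
    ext j
    rw [hz]
    simp only [hT, Multiset.sum_add, Pi.add_apply, Multiset.sum_replicate, smul_zero, Pi.zero_apply, add_zero]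
    refine Fin.lastCases ?_ (fun i => ?_) j
    · rw [up_sum_last, dn_sum_last, a2, b2]
      have : (A : ℤ) - B = t := by omega
      rw [← ht, ← this]; push_cast; ring
    · rw [up_sum_castSucc, dn_sum_castSucc, ← a3, ← b3]
      push_cast; ring
  have hTm : ∀ x ∈ T, x ∈ Ω ∧ IsLatticePoint x := by
    intro x hx
    simp only [hT, Multiset.mem_add, Multiset.mem_map] at hx
    rcases hx with (⟨I, hI, rfl⟩ | ⟨F, hF, rfl⟩) | hx
    · refine ⟨up_mem P (a1 I hI), fun j => Fin.lastCases ⟨1, by simp [up]⟩ (fun i => ?_) j⟩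
      exact ⟨if i ∈ I then 1 else 0, by simp [up, indicator_coe]⟩
    · refine ⟨dn_mem P (b1 F hF), fun j => Fin.lastCases ⟨-1, by simp [dn]⟩ (fun i => ?_) j⟩
      exact ⟨-if i ∈ F then 1 else 0, by simp [dn, indicator_coe]⟩
    · rw [Multiset.eq_of_mem_replicate hx]
      exact ⟨h0Ω, fun j => ⟨0, by simp⟩⟩
  clear_value T
  obtain ⟨l, rfl⟩ := Quot.exists_rep T
  have hl : l.length = m := hTc
  have hs : l.sum = a := by
    rw [← hTs]; exact (Multiset.sum_coe l).symm
  subst hl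
  exact ⟨l.get, fun k => hTm _ (by exact List.get_mem l k), by rw [← hs, ← List.sum_ofFn, List.ofFn_get]⟩



/-! ### Reflexivity -/

/-- Separation of a point from the convex hull of a finite set by a linear functional. -/
lemma separate {d : ℕ} {A : Set (Fin d → ℝ)} (hA : A.Finite) {x : Fin d → ℝ}
    (hx : x ∉ convexHull ℝ A) :
    ∃ (c : Fin d → ℝ) (r : ℝ), (∀ v ∈ A, ∑ i, c i * v i < r) ∧ r < ∑ i, c i * x i := by
  obtain ⟨f, r, h1, h2⟩ := geometric_hahn_banach_closed_point (convex_convexHull ℝ A)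
    (hA.isClosed_convexHull ℝ) hx
  have hf : ∀ v : Fin d → ℝ, f v = ∑ i, f (Pi.single i 1) * v i := by
    intro v
    have e : v = ∑ i, v i • (Pi.single i 1 : Fin d → ℝ) := by
      ext j; simp [Finset.sum_apply, Pi.single_apply]
    conv_lhs => rw [e]
    rw [map_sum]
    refine Finset.sum_congr rfl fun i _ => ?_
    rw [map_smul, smul_eq_mul, mul_comm]
  refine ⟨fun i => f (Pi.single i 1), r, fun v hv => ?_, ?_⟩
  · rw [← hf]; exact h1 v (subset_convexHull ℝ _ hv)
  · rw [← hf]; exact h2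

/-- Separation by an integral functional. -/
lemma separate_int {d : ℕ} {A : Set (Fin d → ℝ)} (hA : A.Finite) {x : Fin d → ℝ}
    (hx : x ∉ convexHull ℝ A) :
    ∃ c : Fin d → ℤ, ∀ v ∈ A, ∑ i, (c i : ℝ) * v i < ∑ i, (c i : ℝ) * x i := by
  obtain ⟨c, r, h1, h2⟩ := separate hA hx
  have hev : ∀ v ∈ A, ∀ᶠ n : ℕ in Filter.atTop,
      ∑ i, ((⌊(n : ℝ) * c i⌋ : ℤ) : ℝ) * v i < ∑ i, ((⌊(n : ℝ) * c i⌋ : ℤ) : ℝ) * x i := by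
    intro v hv
    have hpos : 0 < ∑ i, c i * x i - ∑ i, c i * v i := by linarith [h1 v hv]
    have := (tendsto_natCast_atTop_atTop (R := ℝ)).eventually_gt_atTop
      ((∑ i, |x i - v i|) / (∑ i, c i * x i - ∑ i, c i * v i))
    filter_upwards [this] with n hn
    rw [div_lt_iff₀ hpos] at hn
    have hb : ∀ i, (n : ℝ) * c i * (x i - v i) - |x i - v i| ≤
        ((⌊(n : ℝ) * c i⌋ : ℤ) : ℝ) * (x i - v i) := by
      intro i
      have a1 := Int.floor_le ((n : ℝ) * c i)
      have a2 := (Int.lt_floor_add_one ((n : ℝ) * c i)).le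
      have a3 : |((n : ℝ) * c i - (⌊(n : ℝ) * c i⌋ : ℤ)) * (x i - v i)| ≤ 1 * |x i - v i| := by
        rw [abs_mul]
        refine mul_le_mul_of_nonneg_right ?_ (abs_nonneg _)
        rw [abs_le]; constructor <;> linarith
      have := le_abs_self (((n : ℝ) * c i - (⌊(n : ℝ) * c i⌋ : ℤ)) * (x i - v i))
      linarith
    have hs := Finset.sum_le_sum fun i (_ : i ∈ Finset.univ) => hb i
    rw [Finset.sum_sub_distrib] at hs
    have e1 : ∑ i, (n : ℝ) * c i * (x i - v i) = n * (∑ i, c i * x i - ∑ i, c i * v i) := by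
      rw [← Finset.sum_sub_distrib, Finset.mul_sum]
      exact Finset.sum_congr rfl fun i _ => by ring
    have e2 : ∑ i, ((⌊(n : ℝ) * c i⌋ : ℤ) : ℝ) * (x i - v i) =
        ∑ i, ((⌊(n : ℝ) * c i⌋ : ℤ) : ℝ) * x i - ∑ i, ((⌊(n : ℝ) * c i⌋ : ℤ) : ℝ) * v i := by
      rw [← Finset.sum_sub_distrib]
      exact Finset.sum_congr rfl fun i _ => by ring
    rw [e1, e2] at hs
    linarith
  obtain ⟨n, hn⟩ := ((Filter.eventually_all_finite hA).2 hev).exists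
  exact ⟨_, hn⟩

lemma univ_ideal {d : ℕ} (P : PartialOrder (Fin d)) :
    IsPosetIdeal P ((Finset.univ : Finset (Fin d)) : Set (Fin d)) := by
  intro i _ j _; simp

lemma zero_mem_interior {d : ℕ} {Δ : Set (Finset (Fin d))} (hΔ : IsSimplicialComplex Δ)
    (P : PartialOrder (Fin d)) :
    0 ∈ interior (gammaPolytope (orderPolytope P) (complexPolytope Δ)) := by
  classical
  set K := gammaPolytope (orderPolytope P) (complexPolytope Δ) with hK
  rw [mem_interior_iff_mem_nhds, Metric.mem_nhds_iff]
  have hd0 : (0 : ℝ) < 2 * d + 1 := by positivity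
  refine ⟨1 / (2 * d + 1), by positivity, fun y hy => ?_⟩
  rw [mem_ball_zero_iff] at hy
  set ε : ℝ := 1 / (2 * d + 1) with hε
  have hεd : ε * (2 * d + 1) = 1 := by rw [hε]; field_simp
  have hyi : ∀ i, |y i| ≤ ε := fun i => (norm_le_pi_norm y i).trans hy.le
  set lam : ℝ := (1 + ∑ i, y i) / (d + 1) with hlam
  have hd1 : (0 : ℝ) < d + 1 := by positivity
  have hlame : lam * (d + 1) = 1 + ∑ i, y i := by rw [hlam]; field_simp
  have hsum : -(d * ε) ≤ ∑ i, y i := by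
    have : ∑ i : Fin d, (-ε) ≤ ∑ i, y i :=
      Finset.sum_le_sum fun i _ => (abs_le.1 (hyi i)).1
    simpa using this
  have hlamε : ε ≤ lam := by
    rw [hlam, le_div_iff₀ hd1]; linarith
  have hε0 : 0 < ε := by rw [hε]; positivity
  have hone : (fun _ => 1 : Fin d → ℝ) ∈ K := by
    refine subset_convexHull ℝ _ (Or.inl (subset_convexHull ℝ _ ⟨_, univ_ideal P, ?_⟩))
    ext i; rw [indicator_coe]; simp
  have hneg : ∀ i, (-Pi.single i 1 : Fin d → ℝ) ∈ K := by
    intro i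
    refine subset_convexHull ℝ _ (Or.inr ?_)
    rw [Set.mem_neg, neg_neg]
    refine subset_convexHull ℝ _ ⟨{i}, hΔ.1 i, ?_⟩
    ext j; rw [indicator_coe]; simp [Pi.single_apply]
  have hc : Convex ℝ K := convex_convexHull ℝ _
  have := hc.sum_mem (t := Finset.univ) (w := fun o : Option (Fin d) => o.elim lam fun i => lam - y i)
    (z := fun o : Option (Fin d) => o.elim (fun _ => 1 : Fin d → ℝ) fun i => -Pi.single i 1)
    (by
      rintro (_ | i) _
      · simp; linarith
      · simp; linarith [(abs_le.1 (hyi i)).2])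
    (by
      rw [Fintype.sum_option]
      simp
      linarith)
    (by
      rintro (_ | i) _
      · exact hone
      · exact hneg i)
  refine (congrArg (· ∈ K) ?_).mp this
  rw [Fintype.sum_option]
  ext j
  simp [Finset.sum_apply, Pi.single_apply]

lemma dual_convex {d : ℕ} (K : Set (Fin d → ℝ)) : Convex ℝ (dualPolytope K) := by
  intro x hx z hz a b ha hb hab y hy
  have h1 := mul_le_mul_of_nonneg_left (hx y hy) ha
  have h2 := mul_le_mul_of_nonneg_left (hz y hy) hb
  rw [Finset.mul_sum] at h1 h2
  have : ∑ i, (a • x + b • z) i * y i = ∑ i, a * (x i * y i) + ∑ i, b * (z i * y i) := by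
    rw [← Finset.sum_add_distrib]
    refine Finset.sum_congr rfl fun i _ => ?_
    simp; ring
  rw [this]; linarith

lemma sum_mult_le {d : ℕ} (x : Fin d → ℝ) (L : Multiset (Finset (Fin d)))
    (h : ∀ F ∈ L, ∑ i ∈ F, x i ≤ 1) : ∑ i, (mult L i : ℝ) * x i ≤ L.card := by
  induction L using Multiset.induction with
  | empty => simp
  | cons F L ih =>
    have h1 := ih fun F' hF' => h F' (by simp [hF'])
    have h2 := h F (by simp)
    simp only [mult_cons, Multiset.card_cons]
    push_cast
    simp only [add_mul, Finset.sum_add_distrib, ite_mul, one_mul, zero_mul, Finset.sum_ite_mem,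
      Finset.univ_inter]
    linarith

lemma cov_to_reflexive {d : ℕ} (hd : 1 ≤ d) {Δ : Set (Finset (Fin d))} (hΔ : IsSimplicialComplex Δ)
    (hcov : Cov Δ) (P : PartialOrder (Fin d)) :
    IsReflexive (gammaPolytope (orderPolytope P) (complexPolytope Δ)) := by
  classical
  refine ⟨zero_mem_interior hΔ P, ?_⟩
  set D := dualPolytope (gammaPolytope (orderPolytope P) (complexPolytope Δ)) with hD
  set V : Finset (Fin d → ℝ) := ((Fintype.piFinset fun _ : Fin d => Finset.Icc (-1 : ℤ) d).image
    (fun z i => (z i : ℝ))).filter (· ∈ D) with hV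
  have hVl : ∀ z : Fin d → ℤ, (fun i => (z i : ℝ)) ∈ D → (fun i => (z i : ℝ)) ∈ V := by
    intro z hz
    rw [hV, Finset.mem_filter]
    refine ⟨Finset.mem_image.2 ⟨z, ?_, rfl⟩, hz⟩
    rw [hD, mem_dual] at hz
    have hlow : ∀ i, -1 ≤ z i := by
      intro i
      have := hz.2 _ (hΔ.1 i)
      simp at this
      have : (-1 : ℝ) ≤ z i := by linarith
      exact_mod_cast this
    have hup := hz.1 _ (univ_ideal P)
    have hup : ∑ i, z i ≤ 1 := by exact_mod_cast hup
    rw [Fintype.mem_piFinset]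
    intro i
    rw [Finset.mem_Icc]
    refine ⟨hlow i, ?_⟩
    rw [← Finset.add_sum_erase _ _ (Finset.mem_univ i)] at hup
    have : ∑ j ∈ Finset.univ.erase i, (-1 : ℤ) ≤ ∑ j ∈ Finset.univ.erase i, z j :=
      Finset.sum_le_sum fun j _ => hlow j
    rw [Finset.sum_const, Finset.card_erase_of_mem (Finset.mem_univ i)] at this
    rw [Finset.card_univ, Fintype.card_fin, nsmul_eq_mul] at this
    push_cast [Nat.cast_sub hd] at this
    linarith
  refine ⟨V, ?_, ?_⟩
  · intro v hv
    obtain ⟨z, _, rfl⟩ := Finset.mem_image.1 (Finset.mem_filter.1 hv).1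
    exact fun i => ⟨z i, rfl⟩
  apply Set.Subset.antisymm
  · intro x hx
    by_contra hxV
    obtain ⟨c, hc⟩ := separate_int V.finite_toSet hxV
    obtain ⟨M, g, hM0, hMc, hMa, hMg, hg0, hgI⟩ := push_up P c
    obtain ⟨m0, -, hm0⟩ := Finset.exists_max_image Finset.univ M ⟨⟨0, hd⟩, Finset.mem_univ _⟩
    have hne : (Finset.univ.filter fun C => Cl Δ C).Nonempty := ⟨∅, Finset.mem_filter.2
      ⟨Finset.mem_univ _, by intro i hi; simp at hi⟩⟩
    obtain ⟨C, hC, hCmax⟩ := Finset.exists_max_image _ (fun C => ∑ j ∈ C, (M j - c j)) hne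
    have hC : Cl Δ C := (Finset.mem_filter.1 hC).2
    have hw0 : ∀ j, 0 ≤ M j - c j := fun j => by have := hMc j; omega
    have hWn : 0 ≤ ∑ j ∈ C, (M j - c j) := Finset.sum_nonneg fun j _ => hw0 j
    obtain ⟨A, hA⟩ := Int.eq_ofNat_of_zero_le (hM0 m0)
    obtain ⟨B, hB⟩ := Int.eq_ofNat_of_zero_le hWn
    obtain ⟨L1, a1, a2, a3⟩ := layers P M hM0 hMa A (fun j => by
      have := hm0 j (Finset.mem_univ j); omega)
    obtain ⟨L2, b1, b2, b3⟩ := (hcov B (fun j => M j - c j) hw0 (fun C' hC' => by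
      have := hCmax C' (by simpa using hC')
      omega)).exact hd hΔ hw0
    have hx' := hx
    rw [hD, mem_dual] at hx'
    have e1 := sum_mult_le x L1 (fun I hI => hx'.1 I (a1 I hI))
    have e2 := sum_mult_le (-x) L2 (fun F hF => by simpa using hx'.2 F (b1 F hF))
    have hcx : ∑ i, (c i : ℝ) * x i ≤ A + B := by
      have : ∑ i, (c i : ℝ) * x i = ∑ i, (mult L1 i : ℝ) * x i + ∑ i, (mult L2 i : ℝ) * (-x) i := by
        rw [← Finset.sum_add_distrib]
        refine Finset.sum_congr rfl fun i _ => ?_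
        rw [← a3, ← b3]; push_cast; simp; ring
      rw [this, ← a2, ← b2]; linarith
    -- the optimal lattice point
    let v : Fin d → ℤ := fun i => g m0 i + ∑ j ∈ C, (g j i - if i = j then 1 else 0)
    have hvs : ∀ I : Finset (Fin d), ∑ i ∈ I, v i =
        ∑ i ∈ I, g m0 i + ∑ j ∈ C, (∑ i ∈ I, g j i - if j ∈ I then 1 else 0) := by
      intro I
      simp only [v, Finset.sum_add_distrib]
      congr 1
      rw [Finset.sum_comm]
      refine Finset.sum_congr rfl fun j _ => ?_
      rw [Finset.sum_sub_distrib, Finset.sum_ite_eq']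
    have hvD : (fun i => (v i : ℝ)) ∈ D := by
      rw [hD, mem_dual]
      constructor
      · intro I hI
        have : ∑ i ∈ I, v i ≤ 1 := by
          rw [hvs]
          have h1 : ∑ j ∈ C, (∑ i ∈ I, g j i - if j ∈ I then 1 else 0) ≤ 0 :=
            Finset.sum_nonpos fun j _ => by have := hgI j I hI; linarith
          have h2 := hgI m0 I hI
          split_ifs at h2 <;> linarith
        exact_mod_cast this
      · intro F hF
        have : - ∑ i ∈ F, v i ≤ 1 := by
          rw [hvs, Finset.sum_sub_distrib]
          have h1 := face_clique hΔ hF hC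
          have h2 : 0 ≤ ∑ j ∈ C, ∑ i ∈ F, g j i :=
            Finset.sum_nonneg fun j _ => Finset.sum_nonneg fun i _ => hg0 j i
          have h3 : 0 ≤ ∑ i ∈ F, g m0 i := Finset.sum_nonneg fun i _ => hg0 m0 i
          linarith
        exact_mod_cast this
    have hcv : ∑ i, c i * v i = A + B := by
      have : ∑ i, c i * v i = ∑ i, g m0 i * c i +
          ∑ i, ∑ j ∈ C, (g j i * c i - if i = j then c i else 0) := by
        rw [← Finset.sum_add_distrib]
        refine Finset.sum_congr rfl fun i _ => ?_
        simp only [v, mul_add, Finset.mul_sum]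
        congr 1
        · ring
        · refine Finset.sum_congr rfl fun j _ => ?_
          split_ifs <;> ring
      rw [this, hMg, Finset.sum_comm, hA]
      have e : ∀ j ∈ C, ∑ i, (g j i * c i - if i = j then c i else 0) = M j - c j := by
        intro j _
        rw [Finset.sum_sub_distrib, hMg]; simp
      rw [Finset.sum_congr rfl e, hB]
    have h1 := hc _ (hVl v hvD)
    have h2 : ∑ i, (c i : ℝ) * (v i : ℝ) = A + B := by exact_mod_cast hcv
    linarith
  · refine convexHull_min ?_ (dual_convex _)
    intro v hv
    exact (Finset.mem_filter.1 hv).2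

lemma faces_finite {d : ℕ} (Δ : Set (Finset (Fin d))) :
    {x | ∃ F ∈ Δ, x = indicator (↑F : Set (Fin d))}.Finite := by
  have : {x | ∃ F ∈ Δ, x = indicator (↑F : Set (Fin d))} ⊆
      (fun F : Finset (Fin d) => indicator (F : Set (Fin d))) '' Set.univ := by
    rintro x ⟨F, _, rfl⟩; exact ⟨F, trivial, rfl⟩
  exact (Set.finite_univ.image _).subset this

lemma reflexive_to_cov {d : ℕ} (hd : 1 ≤ d) {Δ : Set (Finset (Fin d))} (hΔ : IsSimplicialComplex Δ)
    (P : PartialOrder (Fin d))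
    (h : IsReflexive (gammaPolytope (orderPolytope P) (complexPolytope Δ))) : Cov Δ := by
  classical
  obtain ⟨-, V, hVl, hV⟩ := h
  -- the fractional statement
  have star : ∀ x : Fin d → ℝ, (∀ i, 0 ≤ x i) → (∀ C, Cl Δ C → ∑ i ∈ C, x i ≤ 1) →
      x ∈ complexPolytope Δ := by
    intro x hx0 hxC
    by_contra hx
    obtain ⟨c, r, h1, h2⟩ := separate (faces_finite Δ) hx
    have h1 : ∀ F ∈ Δ, ∑ i ∈ F, c i < r := by
      intro F hF
      rw [← sum_indicator]; exact h1 _ ⟨F, hF, rfl⟩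
    have hr : 0 < r := by simpa using h1 ∅ (empty_face hd hΔ)
    have hcp : ∀ F ∈ Δ, ∑ i ∈ F, max (c i) 0 ≤ r := by
      intro F hF
      have := h1 (F.filter fun i => 0 < c i) (hΔ.2 F hF _ (Finset.filter_subset _ _))
      rw [Finset.sum_filter] at this
      refine le_trans (Finset.sum_le_sum fun i _ => ?_) this.le
      split_ifs with h
      · rw [max_eq_left h.le]
      · rw [max_eq_right (not_lt.1 h)]
    have hmem : (fun i => -(max (c i) 0 / r)) ∈
        dualPolytope (gammaPolytope (orderPolytope P) (complexPolytope Δ)) := by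
      rw [mem_dual]
      constructor
      · intro I _
        refine le_trans (Finset.sum_nonpos fun i _ => ?_) zero_le_one
        have : 0 ≤ max (c i) 0 / r := div_nonneg (le_max_right _ _) hr.le
        linarith
      · intro F hF
        rw [Finset.sum_neg_distrib, neg_neg, ← Finset.sum_div, div_le_one hr]
        exact hcp F hF
    have hVd : ∀ v ∈ V, v ∈ dualPolytope (gammaPolytope (orderPolytope P) (complexPolytope Δ)) := by
      intro v hv
      rw [hV]; exact subset_convexHull ℝ _ hv
    rw [hV] at hmem
    have := hull_le (-x) 1 ?_ hmem
    · have h3 : ∑ i, c i * x i ≤ ∑ i, max (c i) 0 * x i :=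
        Finset.sum_le_sum fun i _ => mul_le_mul_of_nonneg_right (le_max_left _ _) (hx0 i)
      have h4 : ∑ i, (-x) i * -(max (c i) 0 / r) = (∑ i, max (c i) 0 * x i) / r := by
        rw [Finset.sum_div]
        refine Finset.sum_congr rfl fun i _ => ?_
        simp; ring
      rw [h4, div_le_one hr] at this
      linarith
    · intro v hv
      have hvD := hVd v hv
      rw [mem_dual] at hvD
      choose z hz using hVl v hv
      have hlow : ∀ i, -1 ≤ z i := by
        intro i
        have := hvD.2 _ (hΔ.1 i)
        rw [Finset.sum_singleton, hz] at this
        have : (-1 : ℝ) ≤ z i := by linarith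
        exact_mod_cast this
      have hcl : Cl Δ (Finset.univ.filter fun i => z i < 0) := by
        intro i hi j hj hij hF
        have := hvD.2 _ hF
        rw [Finset.sum_pair hij, hz, hz] at this
        have : -(z i + z j) ≤ 1 := by exact_mod_cast this
        simp at hi hj
        omega
      refine le_trans ?_ (hxC _ hcl)
      rw [Finset.sum_filter]
      refine Finset.sum_le_sum fun i _ => ?_
      rw [hz]
      split_ifs with h
      · have : z i = -1 := by have := hlow i; omega
        simp [this]
      · have : (0 : ℝ) ≤ z i := by exact_mod_cast not_lt.1 h
        have := mul_nonneg (hx0 i) this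
        simp; linarith
  intro N
  induction N with
  | zero =>
    intro u h0 hC
    refine ⟨0, by simp, by simp, fun i => ?_⟩
    simpa using hC _ (cl_singleton i)
  | succ N ih =>
    intro u h0 hC
    have hN : (0 : ℝ) < N + 1 := by positivity
    have hx := star (fun i => (u i : ℝ) / (N + 1)) (fun i => by
      have : (0 : ℝ) ≤ u i := by exact_mod_cast h0 i
      positivity) (fun C hc => by
      rw [← Finset.sum_div, div_le_one hN]
      exact_mod_cast hC C hc)
    -- a face meeting all tight cliques
    obtain ⟨F, hF, hgood⟩ : ∃ F ∈ Δ, ∀ C, Cl Δ C → ∑ i ∈ C, u i = N + 1 →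
        ∃ i ∈ C, i ∈ F := by
      by_contra hcon
      push Not at hcon
      set T := Finset.univ.filter fun C => Cl Δ C ∧ ∑ i ∈ C, u i = N + 1 with hT
      have := hull_le (fun i => ∑ C ∈ T, if i ∈ C then (1 : ℝ) else 0) ((T.card : ℝ) - 1) ?_ hx
      · have e : ∑ i, (∑ C ∈ T, if i ∈ C then (1 : ℝ) else 0) * ((u i : ℝ) / (N + 1)) = T.card := by
          simp only [Finset.sum_mul]
          rw [Finset.sum_comm]
          rw [Finset.sum_congr rfl (g := fun _ => (1 : ℝ))]
          · simp
          · intro C hC'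
            have hC' := (Finset.mem_filter.1 hC').2.2
            simp only [ite_mul, one_mul, zero_mul, Finset.sum_ite_mem, Finset.univ_inter]
            rw [← Finset.sum_div, div_eq_one_iff_eq hN.ne']
            exact_mod_cast hC'
        rw [e] at this
        linarith
      · rintro _ ⟨F, hF, rfl⟩
        rw [sum_indicator, Finset.sum_comm]
        obtain ⟨C0, c1, c2, c3⟩ := hcon F hF
        have hC0 : C0 ∈ T := by simp [hT, c1, c2]
        rw [← Finset.add_sum_erase _ _ hC0]
        have z0 : ∑ i ∈ F, (if i ∈ C0 then (1 : ℝ) else 0) = 0 :=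
          Finset.sum_eq_zero fun i hi => by
            rw [if_neg]; exact fun h => c3 i h hi
        have z1 : ∑ C ∈ T.erase C0, ∑ i ∈ F, (if i ∈ C then (1 : ℝ) else 0) ≤
            ∑ C ∈ T.erase C0, (1 : ℝ) := by
          refine Finset.sum_le_sum fun C hC' => ?_
          have hC' := (Finset.mem_filter.1 (Finset.mem_of_mem_erase hC')).2.1
          have := face_clique hΔ hF hC'
          rw [Finset.sum_ite_mem, Finset.inter_comm, ← Finset.sum_ite_mem] at this
          exact_mod_cast this
        rw [Finset.sum_const, Finset.card_erase_of_mem hC0] at z1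
        have hpos : 1 ≤ T.card := Finset.card_pos.2 ⟨_, hC0⟩
        rw [nsmul_eq_mul, mul_one, Nat.cast_sub hpos] at z1
        rw [z0]
        simpa using z1
    have hIH := ih (fun i => max (u i - if i ∈ F then 1 else 0) 0) (fun i => le_max_right _ _) (by
      intro C hc
      set C' := C.filter fun i => 0 < u i - if i ∈ F then 1 else 0 with hC'
      have hc' : Cl Δ C' := cl_sub hc (Finset.filter_subset _ _)
      have e : ∑ i ∈ C, max (u i - if i ∈ F then 1 else 0) 0 =
          ∑ i ∈ C', (u i - if i ∈ F then 1 else 0) := by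
        rw [hC', Finset.sum_filter]
        refine Finset.sum_congr rfl fun i _ => ?_
        split_ifs <;> omega
      rw [e, Finset.sum_sub_distrib]
      have h1 := hC C' hc'
      have h2 : 0 ≤ ∑ i ∈ C', if i ∈ F then (1 : ℤ) else 0 :=
        Finset.sum_nonneg fun i _ => by split_ifs <;> omega
      push_cast at h1
      by_cases ht : ∑ i ∈ C', u i = N + 1
      · obtain ⟨i, hi, hiF⟩ := hgood C' hc' ht
        have h3 := Finset.single_le_sum (s := C') (f := fun i => if i ∈ F then (1 : ℤ) else 0)
          (fun j _ => by split_ifs <;> omega) hi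
        simp only [hiF, if_true] at h3
        linarith
      · omega)
    obtain ⟨L, l1, l2, l3⟩ := hIH
    refine ⟨F ::ₘ L, ?_, by simp; omega, ?_⟩
    · intro E hE
      rcases Multiset.mem_cons.1 hE with rfl | hE
      · exact hF
      · exact l1 E hE
    · intro i
      have := l3 i
      rw [mult_cons]
      have := le_max_left (u i - if i ∈ F then 1 else 0) 0
      simp only at *
      linarith



/-- **Theorem (Hibi–Tsuchiya, main theorem).**
For a simplicial complex `Δ` on `[d]` (`d ≥ 1`), the following are equivalent:
(i) `Γ(O_P, P_Δ)` is reflexive for some poset `P` on `[d]`;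
(ii) `Γ(O_P, P_Δ)` is reflexive for all posets `P` on `[d]`;
(iii) `Ω(O_P, P_Δ)` has the integer decomposition property for some poset `P` on `[d]`;
(iv) `Ω(O_P, P_Δ)` has the integer decomposition property for all posets `P` on `[d]`;
(v) there is a perfect graph `G` on `[d]` with `P_Δ = Q_G`. -/
theorem main_theorem (d : ℕ) (hd : 1 ≤ d) (Δ : Set (Finset (Fin d)))
    (hΔ : IsSimplicialComplex Δ) :
    List.TFAE
      [ (∃ P : PartialOrder (Fin d),
          IsReflexive (gammaPolytope (orderPolytope P) (complexPolytope Δ))),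
        (∀ P : PartialOrder (Fin d),
          IsReflexive (gammaPolytope (orderPolytope P) (complexPolytope Δ))),
        (∃ P : PartialOrder (Fin d),
          HasIDP (omegaPolytope (orderPolytope P) (complexPolytope Δ))),
        (∀ P : PartialOrder (Fin d),
          HasIDP (omegaPolytope (orderPolytope P) (complexPolytope Δ))),
        (∃ G : SimpleGraph (Fin d),
          IsPerfectGraph G ∧ complexPolytope Δ = stableSetPolytope G) ] := by
  tfae_have 1 → 5 := fun ⟨P, h⟩ => cov_to_five hd hΔ (reflexive_to_cov hd hΔ P h)
  tfae_have 3 → 5 := fun ⟨P, h⟩ => cov_to_five hd hΔ (idp_to_cov hd hΔ P h)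
  tfae_have 5 → 2 := fun h P => cov_to_reflexive hd hΔ (five_to_cov hΔ h) P
  tfae_have 5 → 4 := fun h P => cov_to_idp hd hΔ (five_to_cov hΔ h) P
  tfae_have 2 → 1 := fun h => ⟨inferInstance, h _⟩
  tfae_have 4 → 3 := fun h => ⟨inferInstance, h _⟩
  tfae_finish

end HibiTsuchiya
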